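/- Let n, α, j, k be positive integers and let p be a real number with 4/n^{α−1} ≤ p ≤ 1/2 − 1/n^{α−1}, where n^{α−1} denotes the real number n^α/n, and set c(k) := (1−p)·k/(p − 2/n^{α−1}). If (j : ℝ) > c(k), then ((j−1)/j)·(1−p)·n^α > (1−2p)·n^α + 2n/k + ((k−1)/k)·p·n^α. -/

import Mathlib

/-- Conclusion of Theorem B.4 (Theorem 3) at the level of the bound functions. -/
theorem stmt_11 (n α j k : ℕ) (hn : 0 < n) (hα : 0 < α) (hj : 0 < j) (hk : 0 < k)
    (p : ℝ) (hp4 : 4 / ((n : ℝ) ^ α / (n : ℝ)) ≤ p)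
    (hp12 : p ≤ 1 / 2 - 1 / ((n : ℝ) ^ α / (n : ℝ)))
    (hjc : (j : ℝ) > (1 - p) * (k : ℝ) / (p - 2 / ((n : ℝ) ^ α / (n : ℝ)))) :
    ((j : ℝ) - 1) / (j : ℝ) * (1 - p) * (n : ℝ) ^ α
      > (1 - 2 * p) * (n : ℝ) ^ α + 2 * (n : ℝ) / (k : ℝ)
          + (((k : ℝ) - 1) / (k : ℝ)) * p * (n : ℝ) ^ α := by
  have hn' : (0 : ℝ) < n := by exact_mod_cast hn
  have hj' : (0 : ℝ) < j := by exact_mod_cast hj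
  have hk' : (0 : ℝ) < k := by exact_mod_cast hk
  have hN : (0 : ℝ) < (n : ℝ) ^ α := by positivity
  generalize (n : ℝ) ^ α = N at *
  have e4 : 4 / (N / (n : ℝ)) = 4 * (n / N) := by field_simp
  have e2 : 2 / (N / (n : ℝ)) = 2 * (n / N) := by field_simp
  have hq : 0 < (n : ℝ) / N := by positivity
  rw [e4] at hp4
  rw [e2] at hjc
  have hd : 0 < p - 2 * (n / N) := by linarith
  have h1 : (1 - p) * k < j * (p - 2 * (n / N)) := (div_lt_iff₀ hd).1 hjc
  have h2 : (1 - p) / j < (p - 2 * (n / N)) / k := by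
    rw [div_lt_div_iff₀ hj' hk']
    linarith
  have h3 : 0 < N * ((p - 2 * (n / N)) / k - (1 - p) / j) :=
    mul_pos hN (sub_pos.2 h2)
  have h4 : ((j : ℝ) - 1) / (j : ℝ) * (1 - p) * N
      - ((1 - 2 * p) * N + 2 * (n : ℝ) / (k : ℝ) + (((k : ℝ) - 1) / (k : ℝ)) * p * N)
      = N * ((p - 2 * (n / N)) / k - (1 - p) / j) := by
    field_simp
    ring
  linarith
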